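/- Let p be an odd prime and let A be an integer with ((A²+4)/p) = 1 (Legendre symbol). If p ≡ 1 (mod 4) then T_p(1, −A, −1) ≡ −(A²+4)^{(p−1)/4} (mod p), and if p ≡ 3 (mod 4) then T_p(1, −A, −1) ≡ −(A²+4)^{(p+1)/4} · u_{(p−1)/2}(A)/2 (mod p) (i.e., 2·T_p(1,−A,−1) ≡ −(A²+4)^{(p+1)/4} · u_{(p−1)/2}(A) (mod p)). -/

import Mathlib

/-- The Lucas sequence `u_n(A)` given by `u_0 = 0`, `u_1 = 1` and
`u_{n+1} = A·u_n + u_{n-1}`. -/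
def lucasU (A : ℤ) : ℕ → ℤ
  | 0 => 0
  | 1 => 1
  | n + 2 => A * lucasU A (n + 1) + lucasU A n

theorem prod_univ_eq_mul_prod_Ico {p : ℕ} [Fact p.Prime] (F : ZMod p → ZMod p) :
    ∏ x, F x = F 0 * ∏ i ∈ Finset.Ico 1 p, F i := by
  have hrange : ∏ i ∈ Finset.range p, F i = ∏ x, F x := by
    refine Finset.prod_bij (fun i _ => (i : ZMod p)) (fun _ _ => Finset.mem_univ _) ?_ ?_
      (fun _ _ => rfl)
    · intro a ha b hb hab
      rw [ZMod.natCast_eq_natCast_iff'] at hab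
      rwa [Nat.mod_eq_of_lt (Finset.mem_range.1 ha), Nat.mod_eq_of_lt (Finset.mem_range.1 hb)]
        at hab
    · intro x _
      exact ⟨x.val, Finset.mem_range.2 x.val_lt, ZMod.natCast_zmod_val x⟩
  rw [← hrange, Finset.range_eq_Ico,
    Finset.prod_eq_prod_Ico_succ_bot (Fact.out : p.Prime).pos]
  simp

/-- The elements of `ZMod p` are `0` and `±i` for `1 ≤ i ≤ (p - 1) / 2`. -/
theorem prod_half_system {p : ℕ} [Fact p.Prime] (hodd : Odd p) (F : ZMod p → ZMod p) :
    F 0 * ∏ i ∈ Finset.Icc 1 ((p - 1) / 2), (F i * F (-i)) = ∏ x, F x := by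
  obtain ⟨n, hn⟩ := hodd
  have hhalf : (p - 1) / 2 = n := by omega
  have hupper : ∏ i ∈ Finset.Icc 1 n, F (-i) = ∏ i ∈ Finset.Ico (n + 1) p, F i := by
    refine Finset.prod_bij (fun i _ => p - i) ?_ ?_ ?_ ?_
    · intro i hi
      simp only [Finset.mem_Icc, Finset.mem_Ico] at *
      omega
    · intro a ha b hb hab
      simp only [Finset.mem_Icc] at *
      omega
    · intro b hb
      simp only [Finset.mem_Ico] at hb
      exact ⟨p - b, by simp only [Finset.mem_Icc]; omega, by omega⟩
    · intro i hi
      simp only [Finset.mem_Icc] at hi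
      rw [Nat.cast_sub (by omega)]
      simp
  have hlower : Finset.Icc 1 n = Finset.Ico 1 (n + 1) := by
    ext
    simp only [Finset.mem_Icc, Finset.mem_Ico]
    omega
  rw [hhalf, Finset.prod_mul_distrib, hupper, hlower,
    Finset.prod_Ico_consecutive _ (by omega) (by omega), prod_univ_eq_mul_prod_Ico]

/-- The identity, except that `0` is replaced by `1`. -/
def zeroToOne {K : Type*} [Field K] [DecidableEq K] (x : K) : K := if x = 0 then 1 else x

theorem natCast_ne_zero_of_mem_half {p i : ℕ} (hi : i ∈ Finset.Icc 1 ((p - 1) / 2)) :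
    (i : ZMod p) ≠ 0 := by
  simp only [Finset.mem_Icc] at hi
  rw [Ne, ZMod.natCast_eq_zero_iff]
  intro h
  have := Nat.le_of_dvd (by omega) h
  omega

theorem prod_zeroToOne (p : ℕ) [Fact p.Prime] : ∏ x : ZMod p, zeroToOne x = -1 := by
  rw [prod_univ_eq_mul_prod_Ico, ← ZMod.prod_Ico_one_prime p]
  simp only [zeroToOne, if_true, one_mul]
  refine Finset.prod_congr rfl fun i hi => if_neg ?_
  rw [Finset.mem_Ico] at hi
  rw [ZMod.natCast_eq_zero_iff]
  exact fun h => absurd (Nat.le_of_dvd hi.1 h) (not_le.2 hi.2)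

theorem half_factorial_sq {p : ℕ} [Fact p.Prime] (hodd : Odd p) :
    (∏ i ∈ Finset.Icc 1 ((p - 1) / 2), (i : ZMod p)) ^ 2 = (-1) ^ ((p - 1) / 2 + 1) := by
  have h := prod_half_system hodd (zeroToOne (K := ZMod p))
  have hterm : ∀ i ∈ Finset.Icc 1 ((p - 1) / 2),
      zeroToOne (i : ZMod p) * zeroToOne (-i : ZMod p) = -1 * (i : ZMod p) ^ 2 := by
    intro i hi
    have := natCast_ne_zero_of_mem_half hi
    simp [zeroToOne, this]
    ring
  rw [prod_zeroToOne, Finset.prod_congr rfl hterm, Finset.prod_mul_distrib, Finset.prod_const,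
    Finset.prod_pow, Nat.card_Icc, Nat.add_sub_cancel] at h
  simp only [zeroToOne, if_true, one_mul] at h
  have hsign : ((-1 : ZMod p) ^ ((p - 1) / 2)) ^ 2 = 1 := by
    rw [← pow_mul, mul_comm, pow_mul]
    simp
  rw [pow_succ]
  linear_combination (-1 : ZMod p) ^ ((p - 1) / 2) * h -
    (∏ i ∈ Finset.Icc 1 ((p - 1) / 2), (i : ZMod p)) ^ 2 * hsign

theorem prod_shift {p : ℕ} [Fact p.Prime] (hodd : Odd p) {c : ZMod p} (hc : c ≠ 0) :
    c * ∏ i ∈ Finset.Icc 1 ((p - 1) / 2), (zeroToOne (i - c) * zeroToOne (-i - c)) = 1 := by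
  have h := prod_half_system hodd (fun x => zeroToOne (x - c))
  have hs : ∏ x : ZMod p, zeroToOne (x - c) = -1 := by
    rw [← prod_zeroToOne p]
    exact Equiv.prod_comp (Equiv.subRight c) (zeroToOne (K := ZMod p))
  rw [hs] at h
  simp only [zero_sub] at h
  have h0 : zeroToOne (-c) = -c := by simp [zeroToOne, hc]
  rw [h0] at h
  linear_combination -h

theorem prod_ite_eq_or_eq_neg {p : ℕ} [Fact p.Prime] (hodd : Odd p) {x : ZMod p} (hx : x ≠ 0)
    (c : ZMod p) :
    ∏ i ∈ Finset.Icc 1 ((p - 1) / 2),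
      ((if (i : ZMod p) = x then c else 1) * (if (i : ZMod p) = -x then c else 1)) = c := by
  have h := prod_half_system hodd (fun y => if y = x then c else 1)
  simpa [hx.symm, neg_eq_iff_eq_neg] using h

theorem prod_ite_eq_neg {p : ℕ} [Fact p.Prime] (hodd : Odd p) {x : ZMod p} (hx : x ≠ 0)
    (c : ZMod p) :
    ∏ i ∈ Finset.Icc 1 ((p - 1) / 2), (if (i : ZMod p) = -x then c else 1) =
      if p / 2 < x.val then c else 1 := by
  have hval : (-x).val = p - x.val := by
    rw [ZMod.neg_val, if_neg hx]
  have hlt := x.val_lt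
  obtain ⟨n, hn⟩ := hodd
  have key : ∀ i ∈ Finset.Icc 1 ((p - 1) / 2),
      (if (i : ZMod p) = -x then c else 1) = if i = p - x.val then c else 1 := by
    intro i hi
    simp only [Finset.mem_Icc] at hi
    congr 1
    rw [← hval, eq_iff_iff]
    constructor
    · intro h
      rw [← h, ZMod.val_natCast, Nat.mod_eq_of_lt (by omega)]
    · intro h
      rw [h, ZMod.natCast_zmod_val]
  rw [Finset.prod_congr rfl key, Finset.prod_ite_eq']
  congr 1
  simp only [Finset.mem_Icc, eq_iff_iff]
  omega

/-- Gauss's lemma, as a double product over the half system. -/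
theorem gauss_double_prod {p : ℕ} [Fact p.Prime] (hodd : Odd p) {a : ZMod p} (ha : a ≠ 0) :
    ∏ j ∈ Finset.Icc 1 ((p - 1) / 2), ∏ i ∈ Finset.Icc 1 ((p - 1) / 2),
      (if (i : ZMod p) = -(a * j) then (-1 : ZMod p) else 1) = a ^ ((p - 1) / 2) := by
  have hhalf : (p - 1) / 2 = p / 2 := by
    obtain ⟨n, hn⟩ := hodd
    omega
  have hcast : ((a.val : ℤ) : ZMod p) = a := by simp
  have hp2 : p ≠ 2 := by
    rintro rfl
    exact absurd hodd (by decide)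
  have h := ZMod.gauss_lemma (p := p) hp2 (a := (a.val : ℤ)) (by rwa [hcast])
  have h' := congrArg (Int.cast : ℤ → ZMod p) h
  rw [legendreSym.eq_pow, hcast] at h'
  have hIco : Finset.Ico 1 (p / 2).succ = Finset.Icc 1 ((p - 1) / 2) := by
    ext
    simp only [Finset.mem_Icc, Finset.mem_Ico]
    omega
  rw [Finset.prod_congr rfl fun j hj => prod_ite_eq_neg hodd
    (mul_ne_zero ha (natCast_ne_zero_of_mem_half hj)) (-1), hhalf, h', hIco, hhalf]
  push_cast
  rw [Finset.prod_ite]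
  simp

/-- The norm form `(x - a y) (x - b y)` with `a b = -1`, in terms of its linear factors. -/
theorem zeroToOne_mul_zeroToOne {K : Type*} [Field K] [DecidableEq K] {a b : K} (hab : a * b = -1)
    (hd : a ≠ b) (x : K) {y : K} (hy : y ≠ 0) :
    zeroToOne (x - a * y) * zeroToOne (y + a * x) =
      zeroToOne ((x - a * y) * (x - b * y)) * a * (if x = a * y then (a - b) * y else 1) *
        (if y = -(a * x) then (a - b) * x else 1) := by
  have ha : a ≠ 0 := by
    rintro rfl
    simp at hab
  have hd' : a - b ≠ 0 := sub_ne_zero.2 hd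
  have hfac : y + a * x = a * (x - b * y) := by linear_combination y * hab
  have hiff : y = -(a * x) ↔ x - b * y = 0 := by
    rw [← add_eq_zero_iff_eq_neg, hfac, mul_eq_zero, or_iff_right ha]
  simp only [hiff, ← sub_eq_zero (a := x) (b := a * y), hfac]
  by_cases h1 : x - a * y = 0
  · have h2 : x - b * y = (a - b) * y := by linear_combination h1
    have h3 : x - b * y ≠ 0 := by rw [h2]; exact mul_ne_zero hd' hy
    simp only [zeroToOne, h1, h3, ha, zero_mul, if_true, if_false, mul_eq_zero, or_false,
      one_mul, mul_one]
    rw [h2]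
  · by_cases h2 : x - b * y = 0
    · simp only [zeroToOne, h1, h2, mul_zero, if_true, if_false, mul_one, one_mul]
      linear_combination (x - a * y) * hab - a ^ 2 * h2
    · simp only [zeroToOne, h1, h2, ha, if_false, mul_eq_zero, or_false, mul_one]
      ring

theorem zeroToOne_add {K : Type*} [Field K] [DecidableEq K] (x y : K) :
    zeroToOne (x + y) = zeroToOne (-x - y) * -1 * (if x = -y then -1 else 1) := by
  have h : -x - y = -(x + y) := by ring
  simp only [h, ← add_eq_zero_iff_eq_neg]
  by_cases h0 : x + y = 0
  · simp [zeroToOne, h0]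
  · simp only [zeroToOne, h0, neg_eq_zero, if_false]
    ring

/-- The product of the split norm form over the half system. -/
theorem prod_norm_form {p : ℕ} [Fact p.Prime] (hodd : Odd p) {a b : ZMod p} (hab : a * b = -1)
    (hd : a ≠ b) :
    ∏ i ∈ Finset.Icc 1 ((p - 1) / 2), ∏ j ∈ Finset.Icc 1 ((p - 1) / 2),
      zeroToOne (((i : ZMod p) - a * j) * (i - b * j)) =
    -((a ^ ((p - 1) / 2)) ^ ((p - 1) / 2) * (a - b) ^ ((p - 1) / 2)) := by
  have ha : a ≠ 0 := by
    rintro rfl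
    simp at hab
  have hd' : a - b ≠ 0 := sub_ne_zero.2 hd
  have hsq : ∀ c : ZMod p, c ≠ 0 → (c ^ ((p - 1) / 2)) ^ 2 = 1 := by
    intro c hc
    rw [← pow_mul, Nat.div_mul_cancel, ZMod.pow_card_sub_one_eq_one hc]
    obtain ⟨n, hn⟩ := hodd
    exact ⟨n, by omega⟩
  have hfact := half_factorial_sq hodd
  have hgauss := gauss_double_prod hodd ha
  have hga := hsq a ha
  have hgd := hsq _ hd'
  have hne := @natCast_ne_zero_of_mem_half p
  have hshift : a ^ ((p - 1) / 2) * (∏ j ∈ Finset.Icc 1 ((p - 1) / 2), (j : ZMod p)) *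
      ∏ j ∈ Finset.Icc 1 ((p - 1) / 2), ∏ i ∈ Finset.Icc 1 ((p - 1) / 2),
        (zeroToOne ((i : ZMod p) - a * j) * zeroToOne (-i - a * j)) = 1 := by
    have h := Finset.prod_congr rfl fun j hj => prod_shift hodd (mul_ne_zero ha (@hne j hj))
    rw [Finset.prod_const_one, Finset.prod_mul_distrib, Finset.prod_mul_distrib, Finset.prod_const,
      Nat.card_Icc, Nat.add_sub_cancel] at h
    exact h
  have hdiag : ∏ j ∈ Finset.Icc 1 ((p - 1) / 2), ∏ i ∈ Finset.Icc 1 ((p - 1) / 2),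
      ((if (i : ZMod p) = a * j then (a - b) * j else 1) *
        (if (i : ZMod p) = -(a * j) then (a - b) * j else 1)) =
      (a - b) ^ ((p - 1) / 2) * ∏ j ∈ Finset.Icc 1 ((p - 1) / 2), (j : ZMod p) := by
    rw [Finset.prod_congr rfl fun j hj => prod_ite_eq_or_eq_neg hodd (mul_ne_zero ha (@hne j hj)) _,
      Finset.prod_mul_distrib, Finset.prod_const, Nat.card_Icc, Nat.add_sub_cancel]
  have hfactors : ∏ i ∈ Finset.Icc 1 ((p - 1) / 2), ∏ j ∈ Finset.Icc 1 ((p - 1) / 2),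
      (zeroToOne ((i : ZMod p) - a * j) * zeroToOne ((j : ZMod p) + a * i)) =
      ∏ i ∈ Finset.Icc 1 ((p - 1) / 2), ∏ j ∈ Finset.Icc 1 ((p - 1) / 2),
      (zeroToOne (((i : ZMod p) - a * j) * (i - b * j)) * a *
        (if (i : ZMod p) = a * j then (a - b) * j else 1) *
        (if (j : ZMod p) = -(a * i) then (a - b) * i else 1)) :=
    Finset.prod_congr rfl fun i _ => Finset.prod_congr rfl fun j hj =>
      zeroToOne_mul_zeroToOne hab hd _ (hne hj)
  simp only [zeroToOne_add (_ : ZMod p) (a * _)] at hfactors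
  simp only [Finset.prod_mul_distrib, Finset.prod_const, Nat.card_Icc, Nat.add_sub_cancel]
    at hfactors hshift hdiag
  rw [hgauss, Finset.prod_comm (f := fun i j : ℕ => zeroToOne ((i : ZMod p) - a * j)),
    Finset.prod_comm (f := fun i j : ℕ => if (i : ZMod p) = a * j then (a - b) * j else 1)]
    at hfactors
  generalize (p - 1) / 2 = n at *
  generalize ∏ j ∈ Finset.Icc 1 n, ∏ i ∈ Finset.Icc 1 n, zeroToOne ((i : ZMod p) - a * j) = P at *
  generalize ∏ j ∈ Finset.Icc 1 n, ∏ i ∈ Finset.Icc 1 n, zeroToOne (-(i : ZMod p) - a * j) = Q at *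
  generalize ∏ i ∈ Finset.Icc 1 n, (i : ZMod p) = N at *
  generalize a ^ n = g at *
  generalize (a - b) ^ n = D at *
  generalize ∏ i ∈ Finset.Icc 1 n, ∏ j ∈ Finset.Icc 1 n,
      zeroToOne (((i : ZMod p) - a * j) * (i - b * j)) = T at *
  have hs : ((-1 : ZMod p) ^ n) ^ 2 = 1 := by
    rw [← pow_mul, mul_comm, pow_mul]
    simp
  have hsn : ((-1 : ZMod p) ^ n) ^ n = (-1) ^ n := by
    rcases Nat.even_or_odd n with h | h <;> simp [h.neg_one_pow]
  have hG : (g ^ n) ^ 2 = 1 := by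
    rw [← pow_mul, mul_comm, pow_mul, hga, one_pow]
  rw [mul_assoc (T * g ^ n), hdiag, hsn] at hfactors
  rw [pow_succ (-1 : ZMod p)] at hfact
  generalize (-1 : ZMod p) ^ n = s at *
  generalize g ^ n = G at *
  have hcancel : s * g = -(s * T * G * D * g) := by
    linear_combination g * N * hfactors - s * g * hshift + T * G * D * g * hfact
  have hTGD : T * G * D = -1 := by
    linear_combination s * g * hcancel - (1 + T * G * D) * (g ^ 2 * hs + hga)
  linear_combination G * D * hTGD - T * (D ^ 2 * hG + hgd)

theorem sub_mul_lucasU {R : Type*} [CommRing R] (A : ℤ) {a b : R} (hsum : a + b = A)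
    (hab : a * b = -1) (n : ℕ) : (a - b) * (lucasU A n : R) = a ^ n - b ^ n := by
  induction n using Nat.twoStepInduction with
  | zero => simp [lucasU]
  | one => simp [lucasU]
  | more n ih ih' =>
    rw [lucasU]
    push_cast
    rw [← hsum]
    linear_combination (a + b) * ih' + ih + (a ^ n - b ^ n) * hab

/-- Theorem 1.4(ii): let `p` be an odd prime and `A` an integer with `((A²+4)/p) = 1`, and
`T_p(1,-A,-1) = ∏_{1 ≤ i,j ≤ (p-1)/2, p ∤ i²-Aij-j²} (i² - Aij - j²)`.
If `p ≡ 1 (mod 4)` then `T_p(1,-A,-1) ≡ -(A²+4)^{(p-1)/4} (mod p)`;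
if `p ≡ 3 (mod 4)` then `2·T_p(1,-A,-1) ≡ -(A²+4)^{(p+1)/4}·u_{(p-1)/2}(A) (mod p)`. -/
theorem statement12 (p : ℕ) [Fact p.Prime] (hodd : Odd p) (A : ℤ)
    (hleg : legendreSym p (A ^ 2 + 4) = 1) :
    (p % 4 = 1 →
      (∏ i ∈ Finset.Icc 1 ((p - 1) / 2), ∏ j ∈ Finset.Icc 1 ((p - 1) / 2),
          if (p : ℤ) ∣ ((i : ℤ) ^ 2 - A * (i : ℤ) * (j : ℤ) - (j : ℤ) ^ 2) then 1
          else (i : ℤ) ^ 2 - A * (i : ℤ) * (j : ℤ) - (j : ℤ) ^ 2)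
        ≡ -(A ^ 2 + 4) ^ ((p - 1) / 4) [ZMOD (p : ℤ)]) ∧
    (p % 4 = 3 →
      2 * (∏ i ∈ Finset.Icc 1 ((p - 1) / 2), ∏ j ∈ Finset.Icc 1 ((p - 1) / 2),
          if (p : ℤ) ∣ ((i : ℤ) ^ 2 - A * (i : ℤ) * (j : ℤ) - (j : ℤ) ^ 2) then 1
          else (i : ℤ) ^ 2 - A * (i : ℤ) * (j : ℤ) - (j : ℤ) ^ 2)
        ≡ -((A ^ 2 + 4) ^ ((p + 1) / 4) * lucasU A ((p - 1) / 2)) [ZMOD (p : ℤ)]) := by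
  have hp2 : (2 : ZMod p) ≠ 0 := by
    intro h
    have : p ∣ 2 := (ZMod.natCast_eq_zero_iff 2 p).1 (by exact_mod_cast h)
    have := Nat.le_of_dvd (by norm_num) this
    have := (Fact.out : p.Prime).two_le
    obtain ⟨n, hn⟩ := hodd
    omega
  have hne : ((A ^ 2 + 4 : ℤ) : ZMod p) ≠ 0 := by
    intro h
    rw [(legendreSym.eq_zero_iff p _).2 h] at hleg
    exact zero_ne_one hleg
  obtain ⟨d, hd⟩ := (legendreSym.eq_one_iff p hne).1 hleg
  obtain ⟨a, b, hsum, hab, hdiff⟩ : ∃ a b : ZMod p, a + b = A ∧ a * b = -1 ∧ a - b = d := by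
    push_cast at hd
    refine ⟨(A + d) / 2, (A - d) / 2, by field_simp; ring, ?_, by field_simp; ring⟩
    field_simp
    linear_combination hd
  have hd0 : d ≠ 0 := by
    rintro rfl
    exact hne (by simpa using hd)
  have hne' : a ≠ b := by
    rintro rfl
    exact hd0 (by simpa using hdiff.symm)
  have ha : a ≠ 0 := by
    rintro rfl
    simp at hab
  have hprod := prod_norm_form hodd hab hne'
  have hcast : ((∏ i ∈ Finset.Icc 1 ((p - 1) / 2), ∏ j ∈ Finset.Icc 1 ((p - 1) / 2),
      if (p : ℤ) ∣ ((i : ℤ) ^ 2 - A * (i : ℤ) * (j : ℤ) - (j : ℤ) ^ 2) then 1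
        else (i : ℤ) ^ 2 - A * (i : ℤ) * (j : ℤ) - (j : ℤ) ^ 2 : ℤ) : ZMod p) =
      -((a ^ ((p - 1) / 2)) ^ ((p - 1) / 2) * d ^ ((p - 1) / 2)) := by
    rw [← hdiff, ← hprod, Int.cast_prod]
    refine Finset.prod_congr rfl fun i _ => ?_
    rw [Int.cast_prod]
    refine Finset.prod_congr rfl fun j _ => ?_
    have hform : ((i : ZMod p) - a * j) * (i - b * j) =
        (((i : ℤ) ^ 2 - A * (i : ℤ) * (j : ℤ) - (j : ℤ) ^ 2 : ℤ) : ZMod p) := by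
      push_cast
      rw [← hsum]
      linear_combination (j : ZMod p) ^ 2 * hab
    simp only [hform, zeroToOne, ZMod.intCast_zmod_eq_zero_iff_dvd]
    split_ifs <;> simp
  have hga : (a ^ ((p - 1) / 2)) ^ 2 = 1 := by
    rw [← pow_mul, Nat.div_mul_cancel, ZMod.pow_card_sub_one_eq_one ha]
    obtain ⟨n, hn⟩ := hodd
    exact ⟨n, by omega⟩
  constructor
  · intro hp
    rw [← ZMod.intCast_eq_intCast_iff, hcast, Int.cast_neg, Int.cast_pow, hd, ← pow_two]
    obtain ⟨m, hm⟩ : ∃ m, p = 4 * m + 1 := ⟨p / 4, by omega⟩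
    have h2 : (p - 1) / 2 = 2 * m := by omega
    have h4 : (p - 1) / 4 = m := by omega
    rw [h2] at hga ⊢
    rw [h4, pow_mul (a ^ (2 * m)), hga, one_pow, one_mul, pow_mul]
  · intro hp
    rw [← ZMod.intCast_eq_intCast_iff, Int.cast_mul, hcast, Int.cast_neg, Int.cast_mul,
      Int.cast_pow, hd, ← pow_two]
    have hlucas := sub_mul_lucasU A hsum hab ((p - 1) / 2)
    obtain ⟨m, hm⟩ : ∃ m, p = 4 * m + 3 := ⟨p / 4, by omega⟩
    have h2 : (p - 1) / 2 = 2 * m + 1 := by omega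
    have h4 : (p + 1) / 4 = m + 1 := by omega
    rw [h2] at hga hlucas ⊢
    have hconj : a ^ (2 * m + 1) * b ^ (2 * m + 1) = -1 := by
      rw [← mul_pow, hab, Odd.neg_one_pow ⟨m, rfl⟩]
    have hb : b ^ (2 * m + 1) = -a ^ (2 * m + 1) := by
      linear_combination a ^ (2 * m + 1) * hconj - b ^ (2 * m + 1) * hga
    rw [hdiff, hb] at hlucas
    rw [h4, pow_succ (a ^ (2 * m + 1)), pow_mul (a ^ (2 * m + 1)), hga, one_pow,
      ← pow_mul d]
    push_cast
    rw [show 2 * (m + 1) = 2 * m + 1 + 1 by ring, pow_succ d (2 * m + 1)]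
    linear_combination d ^ (2 * m + 1) * hlucas
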